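/- arXiv:1710.00913 — 2 statements merged into one kernel-verified Lean document; each statement's English description precedes it below -/
import Mathlib

section
/- Let $T_{q_0} = \langle X_n, Q, \pi, \lambda \rangle$ be an initial synchronizing transducer representing a homeomorphism of $\mathfrak{C}_n$. Then $T_{q_0}^{-1} V_n T_{q_0} \subseteq V_n$; that is, for every $f \in V_n$ the homeomorphism $T_{q_0}^{-1} f T_{q_0}$ of $\mathfrak{C}_n$ again lies in $V_n$, so $T_{q_0}^{-1} V_n T_{q_0}$ is a subgroup of $V_n$. -/
open Classical

noncomputable section

/-- `n`-ary Cantor space: infinite words over the alphabet `Fin n`. -/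
abbrev Cantor (n : ℕ) : Type := ℕ → Fin n

/-- The finite word `w` is a prefix of the infinite word `χ`. -/
def PrefixOf {n : ℕ} (w : List (Fin n)) (χ : Cantor n) : Prop :=
  ∀ (i : ℕ) (h : i < w.length), w.get ⟨i, h⟩ = χ i

/-- Concatenation of a finite word with an infinite word. -/
def appendInf {n : ℕ} (w : List (Fin n)) (χ : Cantor n) : Cantor n :=
  fun i => if h : i < w.length then w.get ⟨i, h⟩ else χ (i - w.length)

/-- The cone (basic clopen set) of infinite words having the finite word `w` as prefix. -/
def cone {n : ℕ} (w : List (Fin n)) : Set (Cantor n) :=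
  {χ | PrefixOf w χ}

/-- The length-`k` prefix of an infinite word, as a finite word. -/
def takeW {n : ℕ} (χ : Cantor n) (k : ℕ) : List (Fin n) :=
  List.ofFn (fun i : Fin k => χ i)

/-- A finite family of finite words forming a maximal antichain:
every infinite word has exactly one member of the family as a prefix. -/
def AntichainFam {n m : ℕ} (α : Fin m → List (Fin n)) : Prop :=
  ∀ χ : Cantor n, ∃! i : Fin m, PrefixOf (α i) χ

/-- The group structure on self-homeomorphisms of a topological space,
with `f * g` acting as `g` followed by `f`. -/
instance homeoGroup {X : Type*} [TopologicalSpace X] : Group (X ≃ₜ X) where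
  mul f g := g.trans f
  one := Homeomorph.refl X
  inv := Homeomorph.symm
  mul_assoc a b c := Homeomorph.ext fun _ => rfl
  one_mul a := Homeomorph.ext fun _ => rfl
  mul_one a := Homeomorph.ext fun _ => rfl
  inv_mul_cancel a := Homeomorph.ext fun x => a.symm_apply_apply x

/-- The Higman–Thompson group `Vₙ`, as the set of self-homeomorphisms of Cantor space
which act by exchanging finite prefixes along a pair of maximal antichains. -/
def Vn (n : ℕ) : Set (Cantor n ≃ₜ Cantor n) :=
  {g | ∃ (m : ℕ) (α β : Fin m → List (Fin n)), AntichainFam α ∧ AntichainFam β ∧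
      ∀ (i : Fin m) (χ : Cantor n), g (appendInf (α i) χ) = appendInf (β i) χ}

/-- Conjugation in the paper's right-action convention: `paperConj g v = g⁻¹ v g`,
i.e. the homeomorphism `x ↦ (x) g⁻¹ v g` (first apply `g⁻¹`, then `v`, then `g`). -/
def paperConj {n : ℕ} (g v : Cantor n ≃ₜ Cantor n) : Cantor n ≃ₜ Cantor n :=
  (g.symm.trans v).trans g

/-- `l` is the longest common prefix of the set `A` of infinite words. -/
def IsLCP {n : ℕ} (A : Set (Cantor n)) (l : List (Fin n)) : Prop :=
  (∀ ρ ∈ A, PrefixOf l ρ) ∧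
    ∀ l' : List (Fin n), (∀ ρ ∈ A, PrefixOf l' ρ) → l'.length ≤ l.length

/-- A (not necessarily finite-state) transducer over the alphabet `Fin n`. -/
structure Transducer (n : ℕ) where
  /-- the set of states -/
  Q : Type
  /-- the transition function -/
  tr : Fin n → Q → Q
  /-- the output (rewrite) function -/
  out : Fin n → Q → List (Fin n)

namespace Transducer

variable {n : ℕ}

/-- The transition function extended to finite words. -/
def transStar (T : Transducer n) : List (Fin n) → T.Q → T.Q
  | [], q => q
  | x :: w, q => T.transStar w (T.tr x q)

/-- The output function extended to finite words. -/
def outStar (T : Transducer n) : List (Fin n) → T.Q → List (Fin n)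
  | [], _ => []
  | x :: w, q => T.out x q ++ T.outStar w (T.tr x q)

/-- The initial transducer `T_q` induces the map `f` on Cantor space: the outputs along
ever longer prefixes of `χ` are ever longer prefixes of `f χ`. -/
def Induces (T : Transducer n) (q : T.Q) (f : Cantor n → Cantor n) : Prop :=
  ∀ (χ : Cantor n) (m : ℕ), ∃ k : ℕ,
    m ≤ (T.outStar (takeW χ k) q).length ∧ PrefixOf (T.outStar (takeW χ k) q) (f χ)

/-- The image of the state `q`: the image of Cantor space under the map induced by `T_q`. -/
def stateImage (T : Transducer n) (q : T.Q) : Set (Cantor n) :=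
  {y | ∃ (f : Cantor n → Cantor n) (χ : Cantor n), T.Induces q f ∧ f χ = y}

/-- `T` is synchronizing at level `k`: the state reached after reading any word of
length `k` does not depend on the starting state. -/
def SyncAtLevel (T : Transducer n) (k : ℕ) : Prop :=
  ∀ w : List (Fin n), w.length = k → ∀ q q' : T.Q, T.transStar w q = T.transStar w q'

/-- `T` is synchronizing if it is synchronizing at some level. -/
def Synchronizing (T : Transducer n) : Prop := ∃ k, T.SyncAtLevel k

/-- `T` (inducing the homeomorphism `h` at `q0`) is one-way synchronizing: `T` is
synchronizing, but the inverse homeomorphism is not induced by any finite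
synchronizing transducer (equivalently, the inverse transducer is not synchronizing). -/
def OneWaySync (T : Transducer n) (q0 : T.Q) (h : Cantor n ≃ₜ Cantor n) : Prop :=
  T.Induces q0 ⇑h ∧ T.Synchronizing ∧
    ¬ ∃ (S : Transducer n) (_ : Finite S.Q) (s0 : S.Q),
        S.Induces s0 ⇑h.symm ∧ S.Synchronizing

/-- `T` is equal to its core : every state is reached by reading a word of length `k`
from some state, for every synchronizing level `k`. -/
def EqualToCore (T : Transducer n) : Prop :=
  ∀ k : ℕ, T.SyncAtLevel k → ∀ q : T.Q, ∃ (w : List (Fin n)) (p : T.Q),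
    w.length = k ∧ T.transStar w p = q

/-- Every state of `T` is accessible from `q0`. -/
def Accessible (T : Transducer n) (q0 : T.Q) : Prop :=
  ∀ q : T.Q, ∃ w : List (Fin n), T.transStar w q0 = q

/-- The product transducer `T S` (first act by `T`, then by `S`). -/
def prod (T S : Transducer n) : Transducer n where
  Q := T.Q × S.Q
  tr := fun x p => (T.tr x p.1, S.transStar (T.out x p.1) p.2)
  out := fun x p => S.outStar (T.out x p.1) p.2

/-- `T` is partially invertible: every state induces an injective map on Cantor space
with clopen image. -/
def PartiallyInvertible (T : Transducer n) : Prop :=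
  ∀ q : T.Q, ∃ f : Cantor n → Cantor n,
    T.Induces q f ∧ Function.Injective f ∧ IsClopen (Set.range f)

/-- `T` has no states of incomplete response: for each state `q` and letter `i`, no word
strictly longer than `λ(i,q)` is a common prefix of the outputs on all of the cone `[i]`. -/
def NoIncompleteResponse (T : Transducer n) : Prop :=
  ∀ (q : T.Q) (i x : Fin n),
    ¬ ∀ χ : Cantor n, ∃ k : ℕ, (T.out i q ++ [x]) <+: T.outStar (i :: takeW χ k) q

/-- States `q` of `T` and `p` of `S` are `ω`-equivalent: they induce one and the same
map on Cantor space. -/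
def OmegaEq (T : Transducer n) (q : T.Q) (S : Transducer n) (p : S.Q) : Prop :=
  ∃ f : Cantor n → Cantor n, T.Induces q f ∧ S.Induces p f

/-- `T` is minimal: no states of incomplete response and no pair of distinct
`ω`-equivalent states. -/
def Minimal (T : Transducer n) : Prop :=
  T.NoIncompleteResponse ∧ ∀ q q' : T.Q, T.OmegaEq q T q' → q = q'

/-- The map on Cantor space induced by the state `q` (junk value if none exists). -/
def inducedMap (T : Transducer n) (q : T.Q) : Cantor n → Cantor n :=
  if h : ∃ f, T.Induces q f then h.choose else id

/-- `𝓛_q(α)`: the longest common prefix of the preimage of the cone `[α]` under `T_q`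
(junk value if it does not exist). -/
def lcp (T : Transducer n) (q : T.Q) (α : List (Fin n)) : List (Fin n) :=
  if h : ∃ l, IsLCP {ρ : Cantor n | T.inducedMap q ρ ∈ cone α} l then h.choose else []

/-- The inverse transducer of `T` given by the inversion algorithm, on the set of all
pairs `(w, q)`: reading `x` from `(w,q)` outputs `𝓛_q(wx)` and moves to
`(wx - λ(𝓛_q(wx), q), π(𝓛_q(wx), q))`. -/
def invT (T : Transducer n) : Transducer n where
  Q := List (Fin n) × T.Q
  tr := fun x p =>
    ((p.1 ++ [x]).drop (T.outStar (T.lcp p.2 (p.1 ++ [x])) p.2).length,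
      T.transStar (T.lcp p.2 (p.1 ++ [x])) p.2)
  out := fun x p => T.lcp p.2 (p.1 ++ [x])

/-- Restriction of a transducer to a set of states (transitions leaving the set are
replaced by junk loops; for transition-closed sets this is the honest restriction). -/
def restrictTo (T : Transducer n) (P : T.Q → Prop) : Transducer n where
  Q := {q : T.Q // P q}
  tr := fun x q => if h : P (T.tr x q.1) then ⟨T.tr x q.1, h⟩ else q
  out := fun x q => T.out x q.1

/-- The set of states reachable from `q0`. -/
def reach (T : Transducer n) (q0 : T.Q) : T.Q → Prop :=
  fun q => ∃ w : List (Fin n), T.transStar w q0 = q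

/-- The inverse transducer of the initial transducer `T_{q0}`, with state set the states
accessible from `(ε, q0)`. -/
def invAcc (T : Transducer n) (q0 : T.Q) : Transducer n :=
  (T.invT).restrictTo ((T.invT).reach ([], q0))

/-- A pair `(w,p)` is good if `[w] ⊆ im(T_p)` and `𝓛_p(w) = ε`. -/
def GoodPair (T : Transducer n) (p : List (Fin n) × T.Q) : Prop :=
  cone p.1 ⊆ T.stateImage p.2 ∧
    IsLCP {ρ : Cantor n | T.inducedMap p.2 ρ ∈ cone p.1} []

/-- The partial inverse `T'` of a partially invertible transducer `T`: the inverse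
transducer restricted to the good pairs `(w,p)` with `[w] ⊆ im(T_p)`, `𝓛_p(w) = ε`. -/
def partialInv (T : Transducer n) : Transducer n :=
  (T.invT).restrictTo T.GoodPair

/-- `h` is a completion of `T`: there are a maximal antichain `η` and an effective viable
combination `(ρ, p)` such that `h` maps `η_i χ` to `ρ_i (χ)T_{p_i}`. -/
def IsCompletion (T : Transducer n) (h : Cantor n ≃ₜ Cantor n) : Prop :=
  ∃ (l : ℕ) (η ρ : Fin l → List (Fin n)) (p : Fin l → T.Q)
      (f : Fin l → (Cantor n → Cantor n)),
    l % (n - 1) = 1 % (n - 1) ∧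
    AntichainFam η ∧
    (∀ i, T.Induces (p i) (f i)) ∧
    (⋃ i, appendInf (ρ i) '' Set.range (f i)) = Set.univ ∧
    (∀ i j, i ≠ j →
      Disjoint (appendInf (ρ i) '' Set.range (f i))
        (appendInf (ρ j) '' Set.range (f j))) ∧
    ∀ (i : Fin l) (χ : Cantor n), h (appendInf (η i) χ) = appendInf (ρ i) (f i χ)

/-- The group `𝓗(T)` generated by all completions of `T`. -/
def HGroup (T : Transducer n) : Subgroup (Cantor n ≃ₜ Cantor n) :=
  Subgroup.closure {h | T.IsCompletion h}

/-- The subgroup-generating equivalence relation induced by the automaton underlying a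
transducer `A` with start state `a0` (by Lemma 4.1, two words are related iff the states
they reach are identified by the collapsing procedure, i.e. iff the reached states
transition identically on all sufficiently long words). -/
def simA (A : Transducer n) (a0 : A.Q) (α β : List (Fin n)) : Prop :=
  ∃ i : ℕ, ∀ w : List (Fin n), w.length = i →
    A.transStar w (A.transStar α a0) = A.transStar w (A.transStar β a0)

/-- `if b then T else T'`. -/
def factor (T : Transducer n) (b : Bool) : Transducer n :=
  if b then T else T.partialInv

/-- The product of a nonempty list of factors, each equal to `T` or its partial
inverse `T'`; these products make up the set `Π(T)`. -/
def prodOf (T : Transducer n) : List Bool → Transducer n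
  | [] => T
  | [b] => T.factor b
  | b :: c :: rest => (T.factor b).prod (T.prodOf (c :: rest))

/-- `T` is contracting: every state of every product of copies of `T` and `T'` is
`ω`-equivalent to an initial transducer which, after reading some fixed length of input,
always acts as a state of `T`. -/
def Contracting (T : Transducer n) : Prop :=
  ∀ L : List Bool, L ≠ [] → ∀ q : (T.prodOf L).Q,
    ∃ (V : Transducer n) (p : V.Q) (f : Cantor n → Cantor n),
      (T.prodOf L).Induces q f ∧ V.Induces p f ∧
      ∃ j : ℕ, ∀ w : List (Fin n), w.length = j →
        ∃ (u : T.Q) (g : Cantor n → Cantor n),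
          V.Induces (V.transStar w p) g ∧ T.Induces u g

end Transducer

/-- The element `v` of `Vₙ` preserves the relation `r` on nonempty finite words:
whenever `v` replaces the prefix `α` by `β`, the words `α` and `β` are related. -/
def PreservesRel {n : ℕ} (r : List (Fin n) → List (Fin n) → Prop)
    (g : Cantor n ≃ₜ Cantor n) : Prop :=
  ∀ (α β : List (Fin n)), α ≠ [] → β ≠ [] →
    (∀ χ : Cantor n, g (appendInf α χ) = appendInf β χ) → r α β

/-- The subgroup `V_∼` of `Vₙ` generated by the prefix-exchange homeomorphisms
preserving the relation `r`. -/
def VSim (n : ℕ) (r : List (Fin n) → List (Fin n) → Prop) :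
    Subgroup (Cantor n ≃ₜ Cantor n) :=
  Subgroup.closure {g | g ∈ Vn n ∧ PreservesRel r g}

/-- `f` coincides with `g` on the cone `[α]` (conjugated into the cone) and is the
identity off the cone: the homeomorphism `[α]_g`. -/
def IsRestrTo {n : ℕ} (α : List (Fin n)) (g f : Cantor n ≃ₜ Cantor n) : Prop :=
  (∀ χ : Cantor n, f (appendInf α χ) = appendInf α (g χ)) ∧
  ∀ χ : Cantor n, ¬ PrefixOf α χ → f χ = χ

/-- The Nekrashevych group `Vₙ(G)`: the group generated by `Vₙ` together with all the
homeomorphisms `[α]_g` for `g ∈ G`. -/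
def NekG (n : ℕ) (G : Subgroup (Cantor n ≃ₜ Cantor n)) :
    Subgroup (Cantor n ≃ₜ Cantor n) :=
  Subgroup.closure (Vn n ∪ {f | ∃ (α : List (Fin n)) (g : Cantor n ≃ₜ Cantor n),
    g ∈ G ∧ IsRestrTo α g f})

/-- The homeomorphism `f` locally agrees with the set `G` of homeomorphisms. -/
def LocallyAgrees {n : ℕ} (G : Set (Cantor n ≃ₜ Cantor n))
    (f : Cantor n ≃ₜ Cantor n) : Prop :=
  ∀ x : Cantor n, ∃ U : Set (Cantor n), IsOpen U ∧ x ∈ U ∧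
    ∃ g ∈ G, Set.EqOn ⇑f ⇑g U

/-- A finite synchronous invertible transducer over `Fin n`: each state rewrites single
letters to single letters bijectively. -/
structure SyncTransducer (n : ℕ) where
  /-- the set of states -/
  Q : Type
  /-- there are finitely many states -/
  fin : Finite Q
  /-- the transition function -/
  tr : Fin n → Q → Q
  /-- the (single-letter) output function -/
  out : Fin n → Q → Fin n
  /-- each state rewrites letters bijectively -/
  bij : ∀ q : Q, Function.Bijective fun x => out x q

namespace SyncTransducer

variable {n : ℕ}

/-- The transition function extended to finite words. -/
def trStar (U : SyncTransducer n) : List (Fin n) → U.Q → U.Q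
  | [], q => q
  | x :: w, q => U.trStar w (U.tr x q)

/-- The output function extended to finite words. -/
def outWord (U : SyncTransducer n) : List (Fin n) → U.Q → List (Fin n)
  | [], _ => []
  | x :: w, q => U.out x q :: U.outWord w (U.tr x q)

/-- The map on Cantor space induced by the initial transducer `U_q`. -/
def applyFun (U : SyncTransducer n) (q : U.Q) (χ : Cantor n) : Cantor n :=
  fun i => U.out (χ i) (U.trStar (takeW χ i) q)

/-- The inverse transducer of a synchronous invertible transducer. -/
def inv (U : SyncTransducer n) : SyncTransducer n where
  Q := U.Q
  fin := U.fin
  tr := fun y q => U.tr ((Equiv.ofBijective _ (U.bij q)).symm y) q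
  out := fun y q => (Equiv.ofBijective _ (U.bij q)).symm y
  bij := fun q => (Equiv.ofBijective _ (U.bij q)).symm.bijective

/-- The product of synchronous transducers (first act by `T`, then by `S`). -/
def sprod (T S : SyncTransducer n) : SyncTransducer n where
  Q := T.Q × S.Q
  fin := by
    haveI := T.fin; haveI := S.fin
    infer_instance
  tr := fun x p => (T.tr x p.1, S.tr (T.out x p.1) p.2)
  out := fun x p => S.out (T.out x p.1) p.2
  bij := fun p => (S.bij p.2).comp (T.bij p.1)

/-- `U` is synchronizing at level `k`. -/
def SyncAtLevel (U : SyncTransducer n) (k : ℕ) : Prop :=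
  ∀ w : List (Fin n), w.length = k → ∀ q q' : U.Q, U.trStar w q = U.trStar w q'

/-- `U` is synchronizing. -/
def Synchronizing (U : SyncTransducer n) : Prop := ∃ k, U.SyncAtLevel k

/-- `U` is minimal (under `ω`-equivalence): distinct states induce distinct maps. -/
def Minimal (U : SyncTransducer n) : Prop :=
  ∀ q q' : U.Q, U.applyFun q = U.applyFun q' → q = q'

/-- One-way synchronizing: `U` is synchronizing but the inverse homeomorphism of
`h = U_{q0}` is not induced by any finite synchronizing transducer. -/
def OneWaySync (U : SyncTransducer n) (h : Cantor n ≃ₜ Cantor n) : Prop :=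
  U.Synchronizing ∧
    ¬ ∃ (S : Transducer n) (_ : Finite S.Q) (s0 : S.Q),
        S.Induces s0 ⇑h.symm ∧ S.Synchronizing

/-- `U` is equal to its core. -/
def EqualToCore (U : SyncTransducer n) : Prop :=
  ∀ k : ℕ, U.SyncAtLevel k → ∀ q : U.Q, ∃ (w : List (Fin n)) (p : U.Q),
    w.length = k ∧ U.trStar w p = q

/-- The underlying (asynchronous-format) transducer of a synchronous transducer. -/
def toT (U : SyncTransducer n) : Transducer n :=
  ⟨U.Q, U.tr, fun x q => [U.out x q]⟩

/-- The automaton group `𝒢(U)` generated by `U`: the subgroup of the homeomorphism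
group of Cantor space generated by the homeomorphisms `U_q` for the states `q`. -/
def autG (U : SyncTransducer n) : Subgroup (Cantor n ≃ₜ Cantor n) :=
  Subgroup.closure {f : Cantor n ≃ₜ Cantor n | ∃ q : U.Q, ⇑f = U.applyFun q}

end SyncTransducer

theorem takeW_length {n : ℕ} (χ : Cantor n) (k : ℕ) : (takeW χ k).length = k := by
  simp [takeW]

theorem prefixOf_takeW {n : ℕ} (χ : Cantor n) (k : ℕ) : PrefixOf (takeW χ k) χ := by
  intro i hi
  simp [takeW]

theorem prefixOf_takeW_iff {n : ℕ} (χ ψ : Cantor n) (k : ℕ) :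
    PrefixOf (takeW χ k) ψ ↔ ψ ∈ PiNat.cylinder χ k := by
  simp only [PrefixOf, takeW, PiNat.mem_cylinder_iff, List.get_eq_getElem, List.getElem_ofFn,
    List.length_ofFn]
  exact forall₂_congr fun _ _ => eq_comm

theorem prefixOf_appendInf {n : ℕ} (w : List (Fin n)) (χ : Cantor n) :
    PrefixOf w (appendInf w χ) := by
  intro i hi
  simp [appendInf, hi]

theorem appendInf_length_add {n : ℕ} (w : List (Fin n)) (χ : Cantor n) (i : ℕ) :
    appendInf w χ (w.length + i) = χ i := by
  simp [appendInf]

theorem PrefixOf.exists_eq_appendInf {n : ℕ} {w : List (Fin n)} {χ : Cantor n}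
    (hw : PrefixOf w χ) : ∃ ψ, χ = appendInf w ψ := by
  refine ⟨fun i => χ (w.length + i), ?_⟩
  funext i
  by_cases hi : i < w.length
  · simpa [appendInf, hi] using (hw i hi).symm
  · simp only [appendInf, hi, dite_false]
    congr 1
    omega

theorem appendInf_append {n : ℕ} (u w : List (Fin n)) (χ : Cantor n) :
    appendInf (u ++ w) χ = appendInf u (appendInf w χ) := by
  funext i
  by_cases h₁ : i < u.length
  · have h₂ : i < u.length + w.length := by omega
    simp [appendInf, h₁, h₂]
  · by_cases h₂ : i < u.length + w.length
    · have h₃ : i - u.length < w.length := by omega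
      simp [appendInf, h₁, h₂, h₃, List.getElem_append]
    · have h₃ : ¬ i - u.length < w.length := by omega
      simp [appendInf, h₁, h₂, h₃, Nat.sub_sub]

theorem appendInf_injective {n : ℕ} (w : List (Fin n)) :
    Function.Injective (appendInf w) := by
  intro χ ψ hχ
  funext i
  rw [← appendInf_length_add w χ i, hχ, appendInf_length_add]

theorem prefixOf_append_iff {n : ℕ} (u w : List (Fin n)) (χ : Cantor n) :
    PrefixOf (u ++ w) (appendInf u χ) ↔ PrefixOf w χ := by
  constructor
  · intro hp
    obtain ⟨ψ, hψ⟩ := hp.exists_eq_appendInf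
    rw [appendInf_append] at hψ
    rw [appendInf_injective u hψ]
    exact prefixOf_appendInf w ψ
  · intro hp
    obtain ⟨ψ, rfl⟩ := hp.exists_eq_appendInf
    rw [← appendInf_append]
    exact prefixOf_appendInf _ _

theorem PrefixOf.of_prefix {n : ℕ} {u w : List (Fin n)} {χ : Cantor n}
    (hw : PrefixOf w χ) (huw : u <+: w) : PrefixOf u χ := by
  obtain ⟨v, rfl⟩ := huw
  obtain ⟨ψ, rfl⟩ := hw.exists_eq_appendInf
  rw [appendInf_append]
  exact prefixOf_appendInf _ _

theorem PrefixOf.prefix_of_length_le {n : ℕ} {u w : List (Fin n)} {χ : Cantor n}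
    (hu : PrefixOf u χ) (hw : PrefixOf w χ) (hle : u.length ≤ w.length) : u <+: w := by
  rw [List.prefix_iff_eq_take]
  refine List.ext_getElem (by simpa using hle) fun i h₁ h₂ => ?_
  have a := hu i h₁
  have b := hw i (h₁.trans_le hle)
  simp only [List.get_eq_getElem] at a b
  rw [List.getElem_take, a, b]

theorem PrefixOf.eq_takeW {n : ℕ} {w : List (Fin n)} {χ : Cantor n}
    (hw : PrefixOf w χ) : w = takeW χ w.length :=
  (hw.prefix_of_length_le (prefixOf_takeW χ _) (takeW_length χ _).ge).eq_of_length
    (takeW_length χ _).symm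

theorem takeW_prefix_takeW {n : ℕ} (χ : Cantor n) {j k : ℕ} (hjk : j ≤ k) :
    takeW χ j <+: takeW χ k :=
  (prefixOf_takeW χ j).prefix_of_length_le (prefixOf_takeW χ k) (by simpa [takeW_length] using hjk)

theorem takeW_appendInf {n : ℕ} (w : List (Fin n)) (χ : Cantor n) (k : ℕ) :
    takeW (appendInf w χ) (w.length + k) = w ++ takeW χ k := by
  have hp := (prefixOf_append_iff w (takeW χ k) χ).2 (prefixOf_takeW χ k)
  rw [hp.eq_takeW]
  simp [takeW_length]

theorem exists_takeW_forall_of_mem_nhds {n : ℕ} {y : Cantor n} {s : Set (Cantor n)}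
    (hs : s ∈ nhds y) (m : ℕ) :
    ∃ k, m ≤ k ∧ ∀ χ, appendInf (takeW y k) χ ∈ s := by
  obtain ⟨t, hts, ht, hyt⟩ := mem_nhds_iff.1 hs
  obtain ⟨_, ⟨x, k, rfl⟩, hyc, hct⟩ :=
    (PiNat.isTopologicalBasis_cylinders (fun _ : ℕ => Fin n)).exists_subset_of_mem_open hyt ht
  refine ⟨max m k, le_max_left _ _, fun χ => hts (hct ?_)⟩
  rw [← PiNat.mem_cylinder_iff_eq.1 hyc]
  refine PiNat.cylinder_anti y (le_max_right m k) ?_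
  exact (prefixOf_takeW_iff _ _ _).1 (prefixOf_appendInf _ _)

/-- A homeomorphism that locally acts by exchanging finite prefixes belongs to `Vₙ`. -/
theorem mem_Vn_of_local_prefix_exchange {n : ℕ} (hn : 0 < n) (g : Cantor n ≃ₜ Cantor n)
    (hg : ∀ y : Cantor n, ∃ (k : ℕ) (b : List (Fin n)),
      ∀ χ, g (appendInf (takeW y k) χ) = appendInf b χ) : g ∈ Vn n := by
  choose k b hkb using hg
  obtain ⟨t, ht⟩ := CompactSpace.elim_nhds_subcover (fun y => PiNat.cylinder y (k y))
    fun y => (PiNat.isOpen_cylinder _ y (k y)).mem_nhds (PiNat.self_mem_cylinder y (k y))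
  let L := t.sup k
  have hw : ∀ w : Fin L → Fin n, ∃ c : List (Fin n), ∀ χ,
      g (appendInf (List.ofFn w) χ) = appendInf c χ := by
    intro w
    let z : Cantor n := appendInf (List.ofFn w) fun _ => ⟨0, hn⟩
    have hz : z ∈ ⋃ y ∈ t, PiNat.cylinder y (k y) := ht ▸ Set.mem_univ z
    simp only [Set.mem_iUnion] at hz
    obtain ⟨y, hyt, hzy⟩ := hz
    have hle : k y ≤ L := Finset.le_sup hyt
    obtain ⟨c, hc⟩ := ((prefixOf_takeW_iff y z (k y)).2 hzy).prefix_of_length_le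
      (prefixOf_appendInf (List.ofFn w) _) (by simpa [takeW_length] using hle)
    refine ⟨b y ++ c, fun χ => ?_⟩
    rw [← hc, appendInf_append, hkb, appendInf_append]
  choose c hc using hw
  let e := (Fintype.equivFin (Fin L → Fin n)).symm
  have hα : AntichainFam fun i => List.ofFn (e i) := by
    intro χ
    refine ⟨e.symm fun i => χ i, ?_, ?_⟩
    · simpa [takeW] using prefixOf_takeW χ L
    · intro j hj
      rw [Equiv.eq_symm_apply]
      apply List.ofFn_injective
      simpa [takeW] using hj.eq_takeW
  have key : ∀ (i) (χ : Cantor n),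
      PrefixOf (c (e i)) χ ↔ PrefixOf (List.ofFn (e i)) (g.symm χ) := by
    intro i χ
    constructor
    · intro hp
      obtain ⟨ψ, rfl⟩ := hp.exists_eq_appendInf
      rw [← hc, g.symm_apply_apply]
      exact prefixOf_appendInf _ _
    · intro hp
      obtain ⟨ψ, hψ⟩ := hp.exists_eq_appendInf
      rw [← g.apply_symm_apply χ, hψ, hc]
      exact prefixOf_appendInf _ _
  refine ⟨_, fun i => List.ofFn (e i), fun i => c (e i), hα, fun χ => ?_, fun i χ => hc _ χ⟩
  simpa only [key] using hα (g.symm χ)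

namespace Transducer

theorem transStar_append {n : ℕ} (T : Transducer n) (u w : List (Fin n)) (q : T.Q) :
    T.transStar (u ++ w) q = T.transStar w (T.transStar u q) := by
  induction u generalizing q with
  | nil => rfl
  | cons x u ih => exact ih _

theorem outStar_append {n : ℕ} (T : Transducer n) (u w : List (Fin n)) (q : T.Q) :
    T.outStar (u ++ w) q = T.outStar u q ++ T.outStar w (T.transStar u q) := by
  induction u generalizing q with
  | nil => rfl
  | cons x u ih => simp [outStar, transStar, ih]

theorem outStar_prefix_outStar {n : ℕ} (T : Transducer n) {u w : List (Fin n)} (huw : u <+: w)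
    (q : T.Q) : T.outStar u q <+: T.outStar w q := by
  obtain ⟨v, rfl⟩ := huw
  rw [outStar_append]
  exact List.prefix_append _ _

theorem Induces.prefixOf_outStar {n : ℕ} {T : Transducer n} {q : T.Q}
    {f : Cantor n → Cantor n} (hf : T.Induces q f) (χ : Cantor n) (k : ℕ) :
    PrefixOf (T.outStar (takeW χ k) q) (f χ) := by
  obtain ⟨j, hj, hp⟩ := hf χ (T.outStar (takeW χ k) q).length
  rcases le_total k j with hkj | hjk
  · exact hp.of_prefix (T.outStar_prefix_outStar (takeW_prefix_takeW χ hkj) q)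
  · have hpre := T.outStar_prefix_outStar (takeW_prefix_takeW χ hjk) q
    rwa [hpre.eq_of_length (le_antisymm hpre.length_le hj)] at hp

theorem Induces.prefixOf_outStar_appendInf {n : ℕ} {T : Transducer n} {q : T.Q}
    {f : Cantor n → Cantor n} (hf : T.Induces q f) (w : List (Fin n)) (χ : Cantor n) (k : ℕ) :
    PrefixOf (T.outStar w q ++ T.outStar (takeW χ k) (T.transStar w q)) (f (appendInf w χ)) := by
  rw [← outStar_append, ← takeW_appendInf]
  exact hf.prefixOf_outStar _ _

/-- Outputs along two words leading to the same state have the same tails. -/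
theorem Induces.appendInf_of_transStar_eq {n : ℕ} {T : Transducer n} {q : T.Q}
    {f : Cantor n → Cantor n} (hf : T.Induces q f) {u w : List (Fin n)}
    (huw : T.transStar u q = T.transStar w q) {χ ψ : Cantor n}
    (hψ : f (appendInf u χ) = appendInf (T.outStar u q) ψ) :
    f (appendInf w χ) = appendInf (T.outStar w q) ψ := by
  obtain ⟨ξ, hξ⟩ := ((hf.prefixOf_outStar_appendInf w χ 0).of_prefix
    (List.prefix_append _ _)).exists_eq_appendInf
  rw [hξ]
  congr 1
  funext i
  obtain ⟨j, hj, -⟩ := hf (appendInf u χ) ((T.outStar u q).length + (i + 1))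
  replace hj := hj.trans (T.outStar_prefix_outStar
    (takeW_prefix_takeW (appendInf u χ) (Nat.le_add_left j u.length)) q).length_le
  rw [takeW_appendInf, outStar_append, List.length_append] at hj
  have hu := hf.prefixOf_outStar_appendInf u χ j
  have hw := hf.prefixOf_outStar_appendInf w χ j
  rw [hψ, prefixOf_append_iff] at hu
  rw [hξ, prefixOf_append_iff, ← huw] at hw
  rw [← hu i (by omega), ← hw i (by omega)]

end Transducer

/-- Proposition 2.2. Conjugating `Vₙ` by an initial synchronizing
transducer `T_{q0}` representing a homeomorphism of Cantor space lands inside `Vₙ`: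
`T_{q0}⁻¹ Vₙ T_{q0} ⊆ Vₙ`, so the conjugate is a subgroup of `Vₙ`. -/
theorem conj_of_Vn_by_synchronizing_transducer_subset
    {n : ℕ} (hn : 2 ≤ n) (T : Transducer n) [Finite T.Q] (q0 : T.Q)
    (h : Cantor n ≃ₜ Cantor n) (hInd : T.Induces q0 ⇑h)
    (hSync : T.Synchronizing) :
    paperConj h '' Vn n ⊆ Vn n := by
  rintro _ ⟨v, ⟨m, α, β, hα, -, hv⟩, rfl⟩
  obtain ⟨s, hs⟩ := hSync
  refine mem_Vn_of_local_prefix_exchange (by omega) _ fun y => ?_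
  obtain ⟨i, hi, -⟩ := hα (h.symm y)
  obtain ⟨ψ, hψ⟩ := hi.exists_eq_appendInf
  let w := takeW ψ s
  have hst : T.transStar (α i ++ w) q0 = T.transStar (β i ++ w) q0 := by
    rw [T.transStar_append, T.transStar_append]
    exact hs w (takeW_length _ _) _ _
  have hy : PrefixOf (α i ++ w) (h.symm y) := by
    rw [hψ, prefixOf_append_iff]
    exact prefixOf_takeW _ _
  have hopen : {z | PrefixOf (α i ++ w) (h.symm z)} ∈ nhds y := by
    have hcyl : {z | PrefixOf (α i ++ w) (h.symm z)} =
        h.symm ⁻¹' PiNat.cylinder (h.symm y) (α i ++ w).length := by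
      ext z
      rw [Set.mem_preimage, ← prefixOf_takeW_iff, ← hy.eq_takeW, Set.mem_ofPred_eq]
    rw [hcyl]
    exact ((PiNat.isOpen_cylinder _ _ _).preimage h.symm.continuous).mem_nhds
      (PiNat.self_mem_cylinder _ _)
  obtain ⟨k, hk, hcone⟩ := exists_takeW_forall_of_mem_nhds hopen
    (T.outStar (α i ++ w) q0).length
  have hout : PrefixOf (T.outStar (α i ++ w) q0) y := by
    have := hInd.prefixOf_outStar (h.symm y) (α i ++ w).length
    rwa [← hy.eq_takeW, h.apply_symm_apply] at this
  obtain ⟨c, hc⟩ := hout.prefix_of_length_le (prefixOf_takeW y k) (by rwa [takeW_length])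
  refine ⟨k, T.outStar (β i ++ w) q0 ++ c, fun χ => ?_⟩
  obtain ⟨ξ, hξ⟩ := PrefixOf.exists_eq_appendInf (hcone χ)
  have hhξ : h (appendInf (α i ++ w) ξ) =
      appendInf (T.outStar (α i ++ w) q0) (appendInf c χ) := by
    rw [← hξ, h.apply_symm_apply, ← hc, appendInf_append]
  change h (v (h.symm _)) = _
  rw [hξ, appendInf_append, hv, ← appendInf_append, hInd.appendInf_of_transStar_eq hst hhξ,
    appendInf_append]
end
end

section
/- Let $T$ be an invertible synchronous transducer with inverse $S$, and fix a state $t$ of $T$. Then conjugation by the homeomorphism $T_t$ induces an injective group homomorphism from $\mathcal{G}(TS)$ into $\mathcal{G}(ST)$, and conjugation by $S_{t^{-1}}$ induces an injective group homomorphism from $\mathcal{G}(ST)$ into $\mathcal{G}(TS)$; consequently $\mathcal{G}(TS)$ and $\mathcal{G}(ST)$ have equal cardinality, and if both are finite then $\mathcal{G}(TS) \cong \mathcal{G}(ST)$. -/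
open Classical

noncomputable section

theorem takeW_succ {n : ℕ} (χ : Cantor n) (i : ℕ) :
    takeW χ (i + 1) = takeW χ i ++ [χ i] :=
  List.ofFn_succ_last

theorem paperConj_eq_mul {n : ℕ} (g v : Cantor n ≃ₜ Cantor n) :
    paperConj g v = g * v * g⁻¹ := rfl

theorem paperConj_injective {n : ℕ} (g : Cantor n ≃ₜ Cantor n) :
    Function.Injective (paperConj g) := by
  intro v w h
  simpa [paperConj_eq_mul] using h

/-- If two subgroups of a group conjugate into each other, they have the same cardinality. -/
theorem Subgroup.mk_eq_of_conj_mem {G : Type*} [Group G] {H K : Subgroup G} {a b : G}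
    (hHK : ∀ g ∈ H, a * g * a⁻¹ ∈ K) (hKH : ∀ g ∈ K, b * g * b⁻¹ ∈ H) :
    Cardinal.mk H = Cardinal.mk K := by
  refine le_antisymm
    (Cardinal.mk_le_of_injective (f := fun g : H => (⟨a * g * a⁻¹, hHK g g.2⟩ : K)) ?_)
    (Cardinal.mk_le_of_injective (f := fun g : K => (⟨b * g * b⁻¹, hKH g g.2⟩ : H)) ?_)
  all_goals
    intro g g' h
    simpa using h

/-- A subgroup that conjugates into a finite subgroup of the same cardinality is
isomorphic to it. -/
theorem Subgroup.nonempty_mulEquiv_of_conj_mem {G : Type*} [Group G] {H K : Subgroup G}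
    [Finite K] {a : G} (hHK : ∀ g ∈ H, a * g * a⁻¹ ∈ K)
    (hcard : Cardinal.mk H = Cardinal.mk K) : Nonempty (H ≃* K) := by
  let φ : H →* K := ((MulAut.conj a).toMonoidHom.comp H.subtype).codRestrict K
    fun g => hHK g g.2
  have hφ : Function.Injective φ := fun g g' h =>
    Subtype.ext ((MulAut.conj a).injective (congrArg Subtype.val h))
  obtain ⟨e⟩ := Cardinal.eq.1 hcard
  have : Finite H := Finite.of_equiv K e.symm
  exact ⟨MulEquiv.ofBijective φ
    ((Nat.bijective_iff_injective_and_card φ).2 ⟨hφ, Nat.card_congr e⟩)⟩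

namespace SyncTransducer

variable {n : ℕ}

theorem trStar_append (U : SyncTransducer n) (v w : List (Fin n)) (q : U.Q) :
    U.trStar (v ++ w) q = U.trStar w (U.trStar v q) := by
  induction v generalizing q with
  | nil => rfl
  | cons x v ih => exact ih _

theorem trStar_takeW_succ (U : SyncTransducer n) (χ : Cantor n) (i : ℕ) (q : U.Q) :
    U.trStar (takeW χ (i + 1)) q = U.tr (χ i) (U.trStar (takeW χ i) q) := by
  rw [takeW_succ, trStar_append]
  rfl

theorem isLocallyConstant_trStar_takeW (U : SyncTransducer n) (q : U.Q) (i : ℕ) :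
    IsLocallyConstant fun χ : Cantor n => U.trStar (takeW χ i) q := by
  induction i with
  | zero => exact IsLocallyConstant.const q
  | succ i ih =>
    simp only [trStar_takeW_succ]
    exact ((IsLocallyConstant.iff_continuous _).2 (continuous_apply i)).comp₂ ih U.tr

theorem continuous_applyFun (U : SyncTransducer n) (q : U.Q) :
    Continuous (U.applyFun q) :=
  continuous_pi fun i => (((IsLocallyConstant.iff_continuous _).2 (continuous_apply i)).comp₂
    (U.isLocallyConstant_trStar_takeW q i) U.out).continuous

theorem inv_out_out (U : SyncTransducer n) (x : Fin n) (q : U.Q) :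
    U.inv.out (U.out x q) q = x :=
  (Equiv.ofBijective _ (U.bij q)).symm_apply_apply x

theorem out_inv_out (U : SyncTransducer n) (y : Fin n) (q : U.Q) :
    U.out (U.inv.out y q) q = y :=
  (Equiv.ofBijective _ (U.bij q)).apply_symm_apply y

theorem inv_trStar_takeW_applyFun (U : SyncTransducer n) (q : U.Q) (χ : Cantor n) (i : ℕ) :
    U.inv.trStar (takeW (U.applyFun q χ) i) q = U.trStar (takeW χ i) q := by
  induction i with
  | zero => rfl
  | succ i ih =>
    refine (U.inv.trStar_takeW_succ _ i q).trans ?_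
    refine (congrArg (U.inv.tr _) ih).trans ?_
    refine Eq.trans ?_ (U.trStar_takeW_succ χ i q).symm
    exact congrArg (fun x => U.tr x _) (U.inv_out_out _ _)

theorem trStar_takeW_inv_applyFun (U : SyncTransducer n) (q : U.Q) (χ : Cantor n) (i : ℕ) :
    U.trStar (takeW (U.inv.applyFun q χ) i) q = U.inv.trStar (takeW χ i) q := by
  induction i with
  | zero => rfl
  | succ i ih =>
    refine (U.trStar_takeW_succ _ i q).trans ?_
    refine (congrArg (U.tr _) ih).trans ?_
    exact (U.inv.trStar_takeW_succ χ i q).symm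

/-- The homeomorphism of Cantor space induced by the initial transducer `U_q`. -/
def homeo (U : SyncTransducer n) (q : U.Q) : Cantor n ≃ₜ Cantor n where
  toFun := U.applyFun q
  invFun := U.inv.applyFun q
  left_inv χ := funext fun i =>
    (congrArg (U.inv.out _) (U.inv_trStar_takeW_applyFun q χ i)).trans (U.inv_out_out _ _)
  right_inv χ := funext fun i =>
    (congrArg (U.out _) (U.trStar_takeW_inv_applyFun q χ i)).trans (U.out_inv_out _ _)
  continuous_toFun := U.continuous_applyFun q
  continuous_invFun := U.inv.continuous_applyFun q

theorem trStar_sprod (T S : SyncTransducer n) (p : T.Q) (q : S.Q) (χ : Cantor n) (i : ℕ) :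
    (T.sprod S).trStar (takeW χ i) (p, q) =
      (T.trStar (takeW χ i) p, S.trStar (takeW (T.applyFun p χ) i) q) := by
  induction i with
  | zero => rfl
  | succ i ih =>
    rw [T.trStar_takeW_succ, S.trStar_takeW_succ]
    exact ((T.sprod S).trStar_takeW_succ χ i (p, q)).trans
      (congrArg ((T.sprod S).tr (χ i)) ih)

theorem applyFun_sprod (T S : SyncTransducer n) (p : T.Q) (q : S.Q) :
    (T.sprod S).applyFun (p, q) = S.applyFun q ∘ T.applyFun p :=
  funext fun χ => funext fun i =>
    congrArg ((T.sprod S).out (χ i)) (trStar_sprod T S p q χ i)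

theorem coe_inv_homeo_mul_homeo (U : SyncTransducer n) (p q : U.Q) :
    ⇑((U.homeo q)⁻¹ * U.homeo p) = (U.sprod U.inv).applyFun (p, q) :=
  (applyFun_sprod U U.inv p q).symm

theorem coe_homeo_mul_inv_homeo (U : SyncTransducer n) (p q : U.Q) :
    ⇑(U.homeo q * (U.homeo p)⁻¹) = (U.inv.sprod U).applyFun (p, q) :=
  (applyFun_sprod U.inv U p q).symm

theorem autG_sprod_inv (U : SyncTransducer n) :
    (U.sprod U.inv).autG =
      Subgroup.closure {f | ∃ p q : U.Q, f = (U.homeo q)⁻¹ * U.homeo p} := by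
  refine congrArg Subgroup.closure (Set.ext fun f => ?_)
  constructor
  · rintro ⟨⟨p, q⟩, hf⟩
    exact ⟨p, q, DFunLike.coe_injective (hf.trans (U.coe_inv_homeo_mul_homeo p q).symm)⟩
  · rintro ⟨p, q, rfl⟩
    exact ⟨(p, q), U.coe_inv_homeo_mul_homeo p q⟩

theorem autG_inv_sprod (U : SyncTransducer n) :
    (U.inv.sprod U).autG =
      Subgroup.closure {f | ∃ p q : U.Q, f = U.homeo q * (U.homeo p)⁻¹} := by
  refine congrArg Subgroup.closure (Set.ext fun f => ?_)
  constructor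
  · rintro ⟨⟨p, q⟩, hf⟩
    exact ⟨p, q, DFunLike.coe_injective (hf.trans (U.coe_homeo_mul_inv_homeo p q).symm)⟩
  · rintro ⟨p, q, rfl⟩
    exact ⟨(p, q), U.coe_homeo_mul_inv_homeo p q⟩

theorem conj_mem_autG_inv_sprod (U : SyncTransducer n) (t : U.Q) :
    ∀ g ∈ (U.sprod U.inv).autG, U.homeo t * g * (U.homeo t)⁻¹ ∈ (U.inv.sprod U).autG := by
  have h : (U.sprod U.inv).autG ≤
      (U.inv.sprod U).autG.comap (MulAut.conj (U.homeo t)).toMonoidHom := by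
    rw [autG_sprod_inv, autG_inv_sprod, Subgroup.closure_le]
    rintro _ ⟨p, q, rfl⟩
    have hgen (p q : U.Q) : U.homeo q * (U.homeo p)⁻¹ ∈
        Subgroup.closure {f | ∃ p q : U.Q, f = U.homeo q * (U.homeo p)⁻¹} :=
      Subgroup.subset_closure ⟨p, q, rfl⟩
    have hmul := mul_mem (hgen q t) (hgen t p)
    simpa [mul_assoc] using hmul
  exact fun g hg => h hg

theorem conj_inv_mem_autG_sprod_inv (U : SyncTransducer n) (t : U.Q) :
    ∀ g ∈ (U.inv.sprod U).autG,
      (U.homeo t)⁻¹ * g * (U.homeo t)⁻¹⁻¹ ∈ (U.sprod U.inv).autG := by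
  have h : (U.inv.sprod U).autG ≤
      (U.sprod U.inv).autG.comap (MulAut.conj (U.homeo t)⁻¹).toMonoidHom := by
    rw [autG_sprod_inv, autG_inv_sprod, Subgroup.closure_le]
    rintro _ ⟨p, q, rfl⟩
    have hgen (p q : U.Q) : (U.homeo q)⁻¹ * U.homeo p ∈
        Subgroup.closure {f | ∃ p q : U.Q, f = (U.homeo q)⁻¹ * U.homeo p} :=
      Subgroup.subset_closure ⟨p, q, rfl⟩
    have hmul := mul_mem (hgen q t) (hgen t p)
    simpa [mul_assoc] using hmul
  exact fun g hg => h hg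

end SyncTransducer

/-- For an invertible synchronous transducer `U` with inverse
`S = U.inv` and a fixed state `t`, conjugation by the homeomorphism `U_t` maps
`𝒢(US)` injectively into `𝒢(SU)`, conjugation by `S_{t⁻¹} = U_t⁻¹` maps `𝒢(SU)`
injectively into `𝒢(US)`; consequently the two groups have equal cardinality, and if
both are finite then they are isomorphic. -/
theorem conjugation_between_GTS_and_GST
    {n : ℕ} (hn : 2 ≤ n) (U : SyncTransducer n) (t : U.Q)
    (ht : Cantor n ≃ₜ Cantor n) (hht : ⇑ht = U.applyFun t) :
    (∀ g ∈ SyncTransducer.autG (U.sprod U.inv),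
        paperConj ht g ∈ SyncTransducer.autG (U.inv.sprod U)) ∧
    Set.InjOn (paperConj ht) ↑(SyncTransducer.autG (U.sprod U.inv)) ∧
    (∀ g ∈ SyncTransducer.autG (U.inv.sprod U),
        paperConj ht.symm g ∈ SyncTransducer.autG (U.sprod U.inv)) ∧
    Set.InjOn (paperConj ht.symm) ↑(SyncTransducer.autG (U.inv.sprod U)) ∧
    Cardinal.mk ↥(SyncTransducer.autG (U.sprod U.inv)) =
      Cardinal.mk ↥(SyncTransducer.autG (U.inv.sprod U)) ∧
    (Finite ↥(SyncTransducer.autG (U.sprod U.inv)) →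
      Finite ↥(SyncTransducer.autG (U.inv.sprod U)) →
      Nonempty
        (↥(SyncTransducer.autG (U.sprod U.inv)) ≃*
          ↥(SyncTransducer.autG (U.inv.sprod U)))) := by
  obtain rfl : ht = U.homeo t := DFunLike.coe_injective hht
  have hTS := U.conj_mem_autG_inv_sprod t
  have hST := U.conj_inv_mem_autG_sprod_inv t
  have hcard := Subgroup.mk_eq_of_conj_mem hTS hST
  exact ⟨hTS, (paperConj_injective _).injOn, hST, (paperConj_injective _).injOn, hcard,
    fun _ _ => Subgroup.nonempty_mulEquiv_of_conj_mem hTS hcard⟩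
end
end
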